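/- Let k ≥ 2 and n ≥ k+2. An edge of the (n,k)-star graph S_{n,k} is a residual edge if and only if it is contained in a 3-cycle (triangle) of S_{n,k}. -/

import Mathlib

open Equiv

/-- Vertices of the `(n,k)`-star graph: `k`-permutations of an `n`-set, i.e.
ordered `k`-tuples of distinct elements (positions and values are `0`-indexed,
so "position 1" of the paper is the index `j : Fin k` with `j.1 = 0`). -/
def StarVertex (n k : ℕ) : Type :=
  {a : Fin k → Fin n // Function.Injective a}

/-- `u` and `v` are joined by a residual edge: they differ exactly in position 1. -/
def IsResEdge {n k : ℕ} (u v : StarVertex n k) : Prop :=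
  (∀ j : Fin k, j.1 = 0 → u.1 j ≠ v.1 j) ∧ ∀ j : Fin k, j.1 ≠ 0 → u.1 j = v.1 j

/-- `u` and `v` are joined by a star edge: `v` is obtained from `u` by exchanging
the entries in position 1 and position `i` for some position `i ≠ 1`. -/
def IsStarEdge {n k : ℕ} (u v : StarVertex n k) : Prop :=
  ∃ i : Fin k, i.1 ≠ 0 ∧
    (∀ j : Fin k, j.1 = 0 → v.1 j = u.1 i ∧ v.1 i = u.1 j) ∧
    ∀ j : Fin k, j.1 ≠ 0 → j ≠ i → v.1 j = u.1 j

/-- The `(n,k)`-star graph `S_{n,k}`. -/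
def starGraph (n k : ℕ) : SimpleGraph (StarVertex n k) :=
  SimpleGraph.fromRel fun u v => IsStarEdge u v ∨ IsResEdge u v

/-- A (finite) graph is a Cayley graph if it is isomorphic to the Cayley graph of some
finite group `G` with connection set `S ⊆ G` satisfying `1 ∉ S` and `S = S⁻¹`. -/
def IsCayleyGraph {V : Type*} (Γ : SimpleGraph V) : Prop :=
  ∃ (G : Type) (_ : Group G) (_ : Fintype G) (S : Set G),
    (1 : G) ∉ S ∧ (∀ s ∈ S, s⁻¹ ∈ S) ∧
    Nonempty (Γ ≃g SimpleGraph.fromRel fun g h : G => g⁻¹ * h ∈ S)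

/-- The automorphism group of a graph, as a subgroup of the permutation group
of the vertex set. -/
def graphAut {V : Type*} (Γ : SimpleGraph V) : Subgroup (Equiv.Perm V) where
  carrier := {σ | ∀ u w : V, Γ.Adj (σ u) (σ w) ↔ Γ.Adj u w}
  one_mem' := by intro u w; simp
  mul_mem' := by
    intro a b ha hb u w
    rw [Equiv.Perm.mul_apply, Equiv.Perm.mul_apply, ha, hb]
  inv_mem' := by
    intro a ha u w
    simpa using (ha (a⁻¹ u) (a⁻¹ w)).symm

/-- The copy of `S_{k-1}` inside the symmetric group on the `k` positions:
permutations of the positions `2,…,k` fixing position `1`. (Via the further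
identification of positions `2,…,k` with the corresponding points, this is the
subgroup `S_{k-1} ≤ S_n` of the paper.) -/
def SkSub (k : ℕ) : Subgroup (Equiv.Perm (Fin k)) where
  carrier := {ν | ∀ j : Fin k, j.1 = 0 → ν j = j}
  one_mem' := by intro j hj; simp
  mul_mem' := by
    intro a b ha hb j hj
    rw [Equiv.Perm.mul_apply, hb j hj, ha j hj]
  inv_mem' := by
    intro a ha j hj
    have h : a⁻¹ (a j) = j := by simp
    rwa [ha j hj] at h

/-- The vertex `ē = [1,2,…,k]` of `S_{n,k}`. -/
def eVert (n k : ℕ) (h : k ≤ n) : StarVertex n k :=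
  ⟨fun j => ⟨j.1, lt_of_lt_of_le j.2 h⟩, fun a b hab => Fin.ext (by simpa using congrArg Fin.val hab)⟩

/-- The action `φ(μ,ν)` on vertices: `[a_1,…,a_k] ↦ [μ(a_{ν⁻¹(1)}),…,μ(a_{ν⁻¹(k)})]`. -/
def phi (n k : ℕ) (μ : Equiv.Perm (Fin n)) (ν : Equiv.Perm (Fin k))
    (a : StarVertex n k) : StarVertex n k :=
  ⟨fun j => μ (a.1 (ν⁻¹ j)), fun x y hxy =>
    (Equiv.injective ν⁻¹) (a.2 (Equiv.injective μ hxy))⟩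

/-- `φ(μ,ν)` as a permutation of the vertices of `S_{n,k}`. -/
def phiPerm (n k : ℕ) (μ : Equiv.Perm (Fin n)) (ν : Equiv.Perm (Fin k)) :
    Equiv.Perm (StarVertex n k) where
  toFun := phi n k μ ν
  invFun := phi n k μ⁻¹ ν⁻¹
  left_inv a := Subtype.ext (funext fun j => by simp [phi])
  right_inv a := Subtype.ext (funext fun j => by simp [phi])

/-- A subgroup `H ≤ S_n` is `m`-transitive: it acts transitively on the set of
`m`-permutations (injective `m`-tuples). -/
def IsMultTrans (n m : ℕ) (H : Subgroup (Equiv.Perm (Fin n))) : Prop :=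
  ∀ a b : Fin m → Fin n, Function.Injective a → Function.Injective b →
    ∃ μ ∈ H, ∀ j, μ (a j) = b j

/-- A subgroup `H ≤ S_n` is sharply `m`-transitive: it acts regularly on the set of
`m`-permutations (injective `m`-tuples). -/
def IsSharplyMultTrans (n m : ℕ) (H : Subgroup (Equiv.Perm (Fin n))) : Prop :=
  ∀ a b : Fin m → Fin n, Function.Injective a → Function.Injective b →
    ∃! μ : H, ∀ j, (μ : Equiv.Perm (Fin n)) (a j) = b j

theorem IsResEdge.symm {n k : ℕ} {u v : StarVertex n k} (h : IsResEdge u v) :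
    IsResEdge v u :=
  ⟨fun j hj => (h.1 j hj).symm, fun j hj => (h.2 j hj).symm⟩

theorem IsStarEdge.symm {n k : ℕ} {u v : StarVertex n k} (h : IsStarEdge u v) :
    IsStarEdge v u := by
  obtain ⟨i, hi, hswap, hfix⟩ := h
  exact ⟨i, hi, fun j hj => ⟨(hswap j hj).2.symm, (hswap j hj).1.symm⟩,
    fun j hj hji => (hfix j hj hji).symm⟩

theorem starGraph_adj_iff {n k : ℕ} {u v : StarVertex n k} :
    (starGraph n k).Adj u v ↔ u ≠ v ∧ (IsStarEdge u v ∨ IsResEdge u v) := by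
  rw [starGraph, SimpleGraph.fromRel_adj]
  have hs : IsStarEdge v u → IsStarEdge u v := IsStarEdge.symm
  have hr : IsResEdge v u → IsResEdge u v := IsResEdge.symm
  tauto

theorem IsResEdge.adj {n k : ℕ} (hk : 0 < k) {u v : StarVertex n k} (h : IsResEdge u v) :
    (starGraph n k).Adj u v :=
  starGraph_adj_iff.2 ⟨fun huv => h.1 ⟨0, hk⟩ rfl (by rw [huv]), Or.inr h⟩

/-- The two end points of a residual edge have a common residual neighbour, since some symbol
occurs in neither of them. -/
theorem IsResEdge.exists_common_neighbour {n k : ℕ} (hk : 0 < k) (hn : k + 2 ≤ n)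
    {u v : StarVertex n k} (h : IsResEdge u v) :
    ∃ w, IsResEdge u w ∧ IsResEdge w v := by
  classical
  obtain ⟨x, hx⟩ : ∃ x, x ∉ insert (v.1 ⟨0, hk⟩) (Finset.univ.image u.1) := by
    apply Finset.exists_mem_notMem_of_card_lt_card (t := Finset.univ) _ |>.imp fun _ => And.right
    calc _ ≤ (Finset.univ.image u.1).card + 1 := Finset.card_insert_le _ _
      _ ≤ k + 1 := by simpa using Finset.card_image_le (s := Finset.univ) (f := u.1)
      _ < _ := by simp; omega
  simp only [Finset.mem_insert, Finset.mem_image, Finset.mem_univ, true_and, not_or,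
    not_exists] at hx
  obtain ⟨hxv, hxu⟩ := hx
  have hzero : ∀ j : Fin k, j.1 = 0 → j = ⟨0, hk⟩ := fun j hj => Fin.ext hj
  refine ⟨⟨Function.update u.1 ⟨0, hk⟩ x, ?_⟩, ⟨?_, ?_⟩, ⟨?_, ?_⟩⟩
  · intro a b hab
    have hu := @u.2 a b
    simp only [Function.update_apply] at hab
    grind
  · intro j hj
    simpa [hzero j hj] using hxu ⟨0, hk⟩
  · intro j hj
    exact (Function.update_of_ne (fun e => hj (by rw [e])) _ _).symm
  · intro j hj
    simpa [hzero j hj] using hxv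
  · intro j hj
    exact (Function.update_of_ne (fun e => hj (by rw [e])) _ _).trans (h.2 j hj)

/-- A star edge lies in no triangle. -/
theorem IsStarEdge.not_common_neighbour {n k : ℕ} (hk : 0 < k) {u v w : StarVertex n k}
    (h : IsStarEdge u v) (huw : IsStarEdge u w ∨ IsResEdge u w)
    (hwv : IsStarEdge w v ∨ IsResEdge w v) : False := by
  obtain ⟨i, hi, hswap, -⟩ := h
  obtain ⟨hv0, hvi⟩ := hswap ⟨0, hk⟩ rfl
  have hne : ∀ j : Fin k, j.1 ≠ 0 → u.1 j ≠ u.1 ⟨0, hk⟩ := fun j hj e =>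
    hj (by rw [u.2 e])
  rcases huw with ⟨j, hj, hj0, hjfix⟩ | ⟨hu0, hufix⟩ <;>
    rcases hwv with ⟨l, hl, hl0, hlfix⟩ | ⟨hw0, hwfix⟩
  · obtain ⟨hwz, hwj⟩ := hj0 ⟨0, hk⟩ rfl
    obtain ⟨hvz, hvl⟩ := hl0 ⟨0, hk⟩ rfl
    by_cases hlj : l = j
    · exact hne i hi (by rw [← hv0, hvz, hlj, hwj])
    · have hli : l = i := u.2 (by rw [← hv0, hvz, hjfix l hl hlj])
      exact hne j hj (by rw [← hwz, ← hvl, hli, hvi])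
  · obtain ⟨hwz, hwj⟩ := hj0 ⟨0, hk⟩ rfl
    have hij : i = j := w.2 (by rw [hwfix i hi, hvi, hwj])
    exact hw0 ⟨0, hk⟩ rfl (by rw [hwz, hv0, hij])
  · obtain ⟨hvz, hvl⟩ := hl0 ⟨0, hk⟩ rfl
    have hli : l = i := u.2 (by rw [← hv0, hvz, hufix l hl])
    exact hu0 ⟨0, hk⟩ rfl (by rw [← hvl, hli, hvi])
  · exact hne i hi (by rw [← hvi, hufix i hi, hwfix i hi])

/-- For `k ≥ 2` and `n ≥ k+2`, an edge of `S_{n,k}` is a residual edge if and only if it is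
contained in a 3-cycle (triangle). -/
theorem residual_iff_in_triangle (n k : ℕ) (hk : 2 ≤ k) (hn : k + 2 ≤ n)
    (u v : StarVertex n k) (h : (starGraph n k).Adj u v) :
    IsResEdge u v ↔
      ∃ w, (starGraph n k).Adj u w ∧ (starGraph n k).Adj w v := by
  have hk0 : 0 < k := by omega
  constructor
  · intro hres
    obtain ⟨w, huw, hwv⟩ := hres.exists_common_neighbour hk0 hn
    exact ⟨w, huw.adj hk0, hwv.adj hk0⟩
  · rintro ⟨w, huw, hwv⟩
    refine (starGraph_adj_iff.1 h).2.resolve_left fun hstar => ?_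
    exact hstar.not_common_neighbour hk0 (starGraph_adj_iff.1 huw).2 (starGraph_adj_iff.1 hwv).2
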